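/- arXiv:2403.11244 — 2 statements merged into one kernel-verified Lean document; each statement's English description precedes it below -/
import Mathlib

section
/- Let C_{K,n} = (K/(n+K))·binom(2n+K-1, n) for n ≥ 0 and C_{K,n} = 0 for n < 0 (the convolution powers of the Catalan numbers), and define D_{K,M}(N) = det((C_{K,i+j+M})_{i,j=0}^{N-1}) for integers M and positive integers K, N, with D_{K,M}(0) = 1. Then for every natural number m and every positive integer k: (i) D_{2k,1-k-m}(N) = 0 for N = 1, 2, …, m+k-1; and (ii) for all natural numbers n, D_{2k,1-k-m}(n+m+k) = (-1)^{binom(m+k,2)} · D_{2k,1-k+m}(n). -/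
/-- The convolution powers of the Catalan numbers:
`C_{K,n} = (K/(n+K))·binom(2n+K-1, n)` for `n ≥ 0`, and `C_{K,n} = 0` for `n < 0`. -/
noncomputable def Ccat (K : ℕ) (n : ℤ) : ℚ :=
  if 0 ≤ n then ((K : ℚ) / ((n : ℚ) + (K : ℚ))) * ((2 * n.toNat + K - 1).choose n.toNat)
  else 0

/-- The Hankel determinant `D_{K,M}(N) = det((C_{K,i+j+M}))_{i,j=0}^{N-1}`
(equal to `1` for `N = 0`). -/
noncomputable def Dcat (K : ℕ) (M : ℤ) (N : ℕ) : ℚ :=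
  Matrix.det (Matrix.of fun i j : Fin N => Ccat K ((i : ℤ) + (j : ℤ) + M))

open Finset in
/-- Power-series inverse relation, with coefficients extended by zero to the integers. -/
lemma hk_conv (F G : ℤ → ℚ) (hG : ∀ z < 0, G z = 0)
    (h : ∀ t : ℕ, ∑ s ∈ range (t + 1), G ((t : ℤ) - s) * F s = if t = 0 then 1 else 0)
    (t : ℤ) (M : ℕ) (ht : t < M) :
    ∑ s ∈ range M, G (t - s) * F s = if t = 0 then 1 else 0 := by
  by_cases h0 : t < 0
  · rw [if_neg (by omega)]
    apply Finset.sum_eq_zero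
    intro s _
    rw [hG _ (by omega), zero_mul]
  · lift t to ℕ using (by omega)
    have := h t
    simp only [Nat.cast_eq_zero]
    rw [← this]
    symm
    apply Finset.sum_subset
    · intro x hx
      simp only [mem_range] at *
      omega
    · intro x _ hx
      simp only [mem_range] at *
      rw [hG _ (by omega), zero_mul]

/-- The anti-diagonal permutation matrix. -/
def hkJ (L : ℕ) : Matrix (Fin L) (Fin L) ℚ :=
  Matrix.of fun i j => if (i : ℕ) + j + 1 = L then 1 else 0

lemma hkJ_det (L : ℕ) : (hkJ L).det = (-1) ^ (L.choose 2) := by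
  induction L with
  | zero => simp
  | succ L ih =>
    rw [Matrix.det_succ_row_zero, Finset.sum_eq_single (Fin.last L)]
    · have : (hkJ (L + 1)).submatrix Fin.succ (Fin.last L).succAbove = hkJ L := by
        ext i j
        simp only [hkJ, Matrix.submatrix_apply, Matrix.of_apply, Fin.succAbove_last,
          Fin.val_succ, Fin.val_castSucc]
        congr 1
        apply propext
        omega
      rw [this, ih, Nat.choose_succ_succ' L 1]
      simp [hkJ, pow_add]
    · intro j _ hj
      have : (j : ℕ) ≠ L := fun h => hj (Fin.ext h)
      simp [hkJ, this]
    · simp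

open Finset Matrix in
/-- Hankel determinants of a backwards shifted series through its reciprocal. -/
lemma hk_main (F G : ℤ → ℚ) (hF : ∀ z < 0, F z = 0) (hG : ∀ z < 0, G z = 0)
    (hF0 : F 0 = 1) (hG0 : G 0 = 1)
    (h : ∀ t : ℕ, ∑ s ∈ range (t + 1), G ((t : ℤ) - s) * F s = if t = 0 then 1 else 0)
    (L n : ℕ) :
    Matrix.det (Matrix.of fun i j : Fin (L + n) => F ((i : ℤ) + (j : ℤ) + (1 - L))) =
      (-1) ^ (L.choose 2) *
        Matrix.det (Matrix.of fun i j : Fin n => - G ((i : ℤ) + (j : ℤ) + (L + 1))) := by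
  set H : Matrix (Fin (L + n)) (Fin (L + n)) ℚ :=
    Matrix.of fun i j => F ((i : ℤ) + (j : ℤ) + (1 - L)) with hH
  set P : Matrix (Fin (L + n)) (Fin (L + n)) ℚ :=
    Matrix.of fun i j => G ((i : ℤ) - (j : ℤ)) with hP
  set S : Matrix (Fin n) (Fin n) ℚ :=
    Matrix.of fun i j => - G ((i : ℤ) + (j : ℤ) + (L + 1)) with hS
  set U : Matrix (Fin n) (Fin n) ℚ :=
    Matrix.of fun i j => F ((j : ℤ) - (i : ℤ)) with hU
  have detP : P.det = 1 := by
    rw [Matrix.det_of_isLowerTriangular]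
    · simp [hP, hG0]
    · intro i j hij
      have : (i : ℕ) < j := hij
      simp only [hP, Matrix.of_apply]
      exact hG _ (by omega)
  have detU : U.det = 1 := by
    rw [Matrix.det_of_isUpperTriangular]
    · simp [hU, hF0]
    · intro i j hij
      have : (j : ℕ) < i := hij
      simp only [hU, Matrix.of_apply]
      exact hF _ (by omega)
  have e1 : ∀ (i j : ℕ), i < L + n → j < L →
      ∑ l ∈ range (L + n), G ((i : ℤ) - l) * F ((l : ℤ) + j + (1 - L)) =
        if i + j + 1 = L then 1 else 0 := by
    intro i j hi hj
    obtain ⟨e, he⟩ : ∃ e, L = e + j + 1 := ⟨L - j - 1, by omega⟩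
    have hN : L + n = e + (j + 1 + n) := by omega
    rw [hN, Finset.sum_range_add, Finset.sum_eq_zero, zero_add]
    · have := hk_conv F G hG h ((i : ℤ) - e) (j + 1 + n) (by omega)
      rw [if_congr (show i + j + 1 = L ↔ (i : ℤ) - e = 0 by omega) rfl rfl, ← this]
      apply Finset.sum_congr rfl
      intro s _
      congr 2
      · push_cast; ring
      · rw [he]; push_cast; ring
    · intro l hl
      rw [mem_range] at hl
      rw [hF ((l : ℤ) + j + (1 - L)) (by omega), mul_zero]
  have e2 : ∀ (i : Fin (L + n)) (j : Fin n), L ≤ i →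
      ∑ l ∈ range (L + n), G ((i : ℤ) - l) * F ((l : ℤ) + ((L + j : ℕ) : ℤ) + (1 - L)) =
        - ∑ q ∈ range n, G ((i : ℤ) + q + 1) * F ((j : ℤ) - q) := by
    intro i j hi
    have hc := hk_conv F G hG h ((i : ℤ) + j + 1) ((j + 1) + (L + n))
      (by have := i.2; push_cast; omega)
    rw [if_neg (by omega), Finset.sum_range_add] at hc
    rw [eq_neg_iff_add_eq_zero, add_comm, ← hc]
    congr 1
    · rw [← Finset.sum_range_reflect _ ((j : ℕ) + 1)]
      symm
      apply Finset.sum_subset_zero_on_sdiff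
      · intro x hx
        have := j.2
        simp only [mem_range] at *
        omega
      · intro x hx
        simp only [mem_sdiff, mem_range] at hx
        rw [hF ((j : ℤ) - x) (by omega), mul_zero]
      · intro x hx
        rw [mem_range] at hx
        rw [show (((j : ℕ) + 1 - 1 - x : ℕ) : ℤ) = (j : ℤ) - x by omega]
        congr 2
        ring
    · apply Finset.sum_congr rfl
      intro s _
      congr 2
      · push_cast; ring
      · push_cast; ring
  have key : (P * H).submatrix finSumFinEquiv finSumFinEquiv =
      Matrix.fromBlocks (hkJ L) ((P * H).submatrix (Fin.castAdd n) (Fin.natAdd L)) 0 (S * U) := by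
    ext i j
    rcases i with i | i <;> rcases j with j | j
    · simp only [submatrix_apply, finSumFinEquiv_apply_left, fromBlocks_apply₁₁, mul_apply, hP, hH,
        of_apply, hkJ]
      have := e1 (Fin.castAdd n i) j (Fin.castAdd n i).2 j.2
      rw [← Fin.sum_univ_eq_sum_range
        (fun l => G (((Fin.castAdd n i : ℕ) : ℤ) - l) * F ((l : ℤ) + j + (1 - L)))] at this
      simpa using this
    · simp
    · simp only [submatrix_apply, finSumFinEquiv_apply_left, finSumFinEquiv_apply_right,
        fromBlocks_apply₂₁, mul_apply, hP, hH, of_apply, Matrix.zero_apply]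
      have := e1 (Fin.natAdd L i) j (Fin.natAdd L i).2 j.2
      rw [← Fin.sum_univ_eq_sum_range
        (fun l => G (((Fin.natAdd L i : ℕ) : ℤ) - l) * F ((l : ℤ) + j + (1 - L))),
        if_neg (by simp; omega)] at this
      simpa using this
    · simp only [submatrix_apply, finSumFinEquiv_apply_right,
        fromBlocks_apply₂₂, mul_apply, hP, hH, hS, hU, of_apply]
      have := e2 (Fin.natAdd L i) j (by simp)
      rw [← Fin.sum_univ_eq_sum_range
        (fun l => G (((Fin.natAdd L i : ℕ) : ℤ) - l) * F ((l : ℤ) + ((L + j : ℕ) : ℤ) + (1 - L))),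
        ← Fin.sum_univ_eq_sum_range
        (fun q => G (((Fin.natAdd L i : ℕ) : ℤ) + q + 1) * F ((j : ℤ) - q)),
        ← Finset.sum_neg_distrib] at this
      refine Eq.trans ?_ (this.trans ?_)
      · simp
      · apply Finset.sum_congr rfl
        intro q _
        rw [neg_mul]
        congr 3
        simp
        ring
  have d1 : H.det = (P * H).det := by rw [Matrix.det_mul, detP, one_mul]
  rw [d1, ← Matrix.det_submatrix_equiv_self finSumFinEquiv, key, Matrix.det_fromBlocks_zero₂₁,
    hkJ_det, Matrix.det_mul, detU, mul_one]

open PowerSeries in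
/-- Catalan series over the rationals. -/
lemma hk_exists_cat : ∃ c : PowerSeries ℚ, c = 1 + X * c ^ 2 := by
  refine ⟨PowerSeries.map (Nat.castRingHom ℚ) catalanSeries, ?_⟩
  conv_lhs => rw [← catalanSeries_sq_mul_X_add_one]
  simp
  ring

open PowerSeries in
lemma hk_coeff_zero (c : PowerSeries ℚ) (hc : c = 1 + X * c ^ 2) (K : ℕ) :
    coeff 0 (c ^ K) = 1 := by
  have : constantCoeff c = 1 := by rw [hc]; simp
  simp [this]

open PowerSeries in
lemma hk_coeff_succ (c : PowerSeries ℚ) (hc : c = 1 + X * c ^ 2) (n K : ℕ) :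
    coeff (n + 1) (c ^ K) =
      (K : ℚ) / ((n + 1 : ℕ) + K) * ((2 * (n + 1) + K - 1).choose (n + 1)) := by
  have hrec : ∀ n K : ℕ, coeff (n + 1) (c ^ (K + 1)) =
      coeff (n + 1) (c ^ K) + coeff n (c ^ (K + 2)) := by
    intro n K
    have : c ^ (K + 1) = c ^ K + X * c ^ (K + 2) := by
      calc c ^ (K + 1) = c ^ K * c := pow_succ _ _
        _ = c ^ K * (1 + X * c ^ 2) := by rw [← hc]
        _ = _ := by ring
    rw [this, map_add, coeff_succ_X_mul]
  have ident : ∀ n K : ℕ, ((K + 1 : ℕ) : ℚ) / ((n + 1 : ℕ) + (K + 1 : ℕ)) *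
        ((2 * (n + 1) + (K + 1) - 1).choose (n + 1)) =
      (K : ℚ) / ((n + 1 : ℕ) + K) * ((2 * (n + 1) + K - 1).choose (n + 1)) +
      ((K + 2 : ℕ) : ℚ) / ((n : ℚ) + (K + 2 : ℕ)) * ((2 * n + (K + 2) - 1).choose n) := by
    intro n K
    rw [show 2 * (n + 1) + (K + 1) - 1 = (2 * n + K + 1) + 1 by omega,
      show 2 * (n + 1) + K - 1 = 2 * n + K + 1 by omega,
      show 2 * n + (K + 2) - 1 = 2 * n + K + 1 by omega, Nat.choose_succ_succ']
    have hB := Nat.choose_succ_right_eq (2 * n + K + 1) n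
    rw [show 2 * n + K + 1 - n = n + K + 1 by omega] at hB
    have hB' : (((2 * n + K + 1).choose (n + 1) : ℕ) : ℚ) =
        (2 * n + K + 1).choose n * (n + K + 1) / (n + 1) := by
      rw [eq_div_iff (by positivity)]
      exact_mod_cast hB
    push_cast
    rw [hB']
    have h1 : (n : ℚ) + 1 ≠ 0 := by positivity
    have h2 : (n : ℚ) + 1 + K ≠ 0 := by positivity
    have h3 : (n : ℚ) + 1 + (K + 1) ≠ 0 := by positivity
    have h4 : (n : ℚ) + (K + 2) ≠ 0 := by positivity
    field_simp
    ring
  induction n generalizing K with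
  | zero =>
    induction K with
    | zero => simp [coeff_one]
    | succ K ih =>
      rw [hrec, ih, ident 0 K, hk_coeff_zero c hc]
      congr 1
      have : ((K + 2 : ℕ) : ℚ) ≠ 0 := by positivity
      simp only [Nat.cast_zero, zero_add, Nat.choose_zero_right, Nat.cast_one, mul_one]
      rw [div_self this]
  | succ n ihn =>
    induction K with
    | zero => simp [coeff_one]
    | succ K ih => rw [hrec, ih, ident (n + 1) K, ihn (K + 2)]

open PowerSeries in
lemma hk_Ccat (c : PowerSeries ℚ) (hc : c = 1 + X * c ^ 2) (K : ℕ) (hK : 0 < K) (n : ℕ) :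
    Ccat K n = coeff n (c ^ K) := by
  have hK' : (K : ℚ) ≠ 0 := by positivity
  rcases n with _ | n
  · rw [hk_coeff_zero c hc]
    simp [Ccat, hK']
  · rw [hk_coeff_succ c hc, Ccat, if_pos (by positivity)]
    simp only [Int.toNat_natCast, Int.cast_natCast]

open PowerSeries in
lemma hk_lucas (c : PowerSeries ℚ) (hc : c = 1 + X * c ^ 2) (j : ℕ) :
    (∀ n, j < 2 * n → coeff n ((1 - X * c) ^ j + (X * c) ^ j) = 0) ∧
    (∀ n, j + 1 < 2 * n → coeff n ((1 - X * c) ^ (j + 1) + (X * c) ^ (j + 1)) = 0) := by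
  induction j with
  | zero =>
    constructor <;> intro n hn
    · simp [coeff_one]; omega
    · simp [coeff_one]; omega
  | succ j ih =>
    refine ⟨ih.2, ?_⟩
    intro n hn
    obtain ⟨n, rfl⟩ : ∃ p, n = p + 1 := ⟨n - 1, by omega⟩
    have huv : (1 - X * c) * (X * c) = X := by
      have : (1 - X * c) * (X * c) = X * (c - X * c ^ 2) := by ring
      rw [this]
      have : c - X * c ^ 2 = 1 := by
        nth_rewrite 1 [hc]
        ring
      rw [this, mul_one]
    have : (1 - X * c) ^ (j + 1 + 1) + (X * c) ^ (j + 1 + 1) =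
        ((1 - X * c) ^ (j + 1) + (X * c) ^ (j + 1)) -
          ((1 - X * c) * (X * c)) * ((1 - X * c) ^ j + (X * c) ^ j) := by ring
    rw [this, huv, map_sub, coeff_succ_X_mul, ih.2 _ (by omega), ih.1 _ (by omega), sub_zero]

/-- Theorem 1: vanishing and quasi-periodicity of the Hankel determinants
`D_{2k,1-k-m}` of backwards shifted even convolution powers of Catalan numbers. -/
theorem stmt6 (m : ℕ) (k : ℕ) (hk : 0 < k) :
    (∀ N : ℕ, 1 ≤ N → N ≤ m + k - 1 →
        Dcat (2 * k) (1 - (k : ℤ) - (m : ℤ)) N = 0) ∧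
      (∀ n : ℕ,
        Dcat (2 * k) (1 - (k : ℤ) - (m : ℤ)) (n + m + k) =
          (-1 : ℚ) ^ ((m + k).choose 2) * Dcat (2 * k) (1 - (k : ℤ) + (m : ℤ)) n) := by
  constructor
  · intro N h1 h2
    rw [Dcat]
    apply Matrix.det_eq_zero_of_row_eq_zero (⟨0, h1⟩ : Fin N)
    intro j
    have := j.2
    simp only [Matrix.of_apply, Ccat]
    rw [if_neg (by push_cast; omega)]
  · intro n
    obtain ⟨c, hc⟩ := hk_exists_cat
    have hK : 0 < 2 * k := by omega
    set g : PowerSeries ℚ := (1 - PowerSeries.X * c) ^ (2 * k) with hg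
    have hcu : c * (1 - PowerSeries.X * c) = 1 := by
      have h1 : c * (1 - PowerSeries.X * c) = c - PowerSeries.X * c ^ 2 := by ring
      rw [h1]
      nth_rewrite 1 [hc]
      ring
    have hgf : g * c ^ (2 * k) = 1 := by
      rw [hg, ← mul_pow, mul_comm, hcu, one_pow]
    set G : ℤ → ℚ := fun z => if 0 ≤ z then PowerSeries.coeff z.toNat g else 0 with hG
    have hGn : ∀ p : ℕ, G p = PowerSeries.coeff p g := by
      intro p
      simp [hG]
    have hneg : ∀ z < 0, Ccat (2 * k) z = 0 := by
      intro z hz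
      rw [Ccat, if_neg (by omega)]
    have hmain := hk_main (Ccat (2 * k)) G hneg
      (by intro z hz; simp only [hG]; rw [if_neg (by omega)])
      (by
        have := hk_Ccat c hc (2 * k) hK 0
        rw [hk_coeff_zero c hc] at this
        simpa using this)
      (by
        have := hGn 0
        rw [hg] at this
        simpa using this)
      (by
        intro t
        have h1 : PowerSeries.coeff t (c ^ (2 * k) * g) = if t = 0 then 1 else 0 := by
          rw [mul_comm, hgf, PowerSeries.coeff_one]
        rw [← h1, PowerSeries.coeff_mul,
          Finset.Nat.sum_antidiagonal_eq_sum_range_succ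
            (fun a b => PowerSeries.coeff a (c ^ (2 * k)) * PowerSeries.coeff b g)]
        apply Finset.sum_congr rfl
        intro s hs
        rw [Finset.mem_range] at hs
        rw [hk_Ccat c hc (2 * k) hK, show (t : ℤ) - s = ((t - s : ℕ) : ℤ) by omega, hGn, mul_comm])
      (m + k) n
    have hGC : ∀ p : ℕ, k < p → - G p = Ccat (2 * k) ((p : ℤ) - 2 * k) := by
      intro p hp
      have h1 := (hk_lucas c hc (2 * k)).1 p (by omega)
      rw [map_add, ← hg, mul_pow, PowerSeries.coeff_X_pow_mul'] at h1
      rw [hGn]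
      split_ifs at h1 with h2
      · rw [show (p : ℤ) - 2 * k = ((p - 2 * k : ℕ) : ℤ) by omega, hk_Ccat c hc (2 * k) hK]
        linarith
      · rw [hneg _ (by omega)]
        linarith
    rw [show n + m + k = (m + k) + n by omega, Dcat, Dcat]
    have a1 : (1 - (k : ℤ) - m) = 1 - ((m + k : ℕ) : ℤ) := by push_cast; ring
    rw [a1, hmain]
    congr 3
    ext i j
    rw [show (i : ℤ) + (j : ℤ) + (((m + k : ℕ) : ℤ) + 1) = ((i + j + (m + k + 1) : ℕ) : ℤ) by
      push_cast; ring, hGC _ (by omega)]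
    congr 1
    push_cast
    ring
end

section
/- Let C_{K,n} = (K/(n+K))·binom(2n+K-1, n) for n ≥ 0 and C_{K,n} = 0 for n < 0, and define D_{K,M}(N) = det((C_{K,i+j+M})_{i,j=0}^{N-1}) with D_{K,M}(0) = 1. Then for every positive integer k: D_{2k+1,-k}((2k+1)·n) = (-1)^{k·n} and D_{2k+1,-k}((2k+1)·n + k + 1) = (-1)^{k·n + binom(k+1,2)} for all natural numbers n, and D_{2k+1,-k}(N) = 0 for every other positive integer N (i.e. all N not of either of these two forms). -/
namespace HankelCat

open Polynomial in
/-- The matrix `L(p_i q_j)` for monic `p_i, q_j` has the same determinant as the Hankel matrix. -/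
theorem det_monic {R : Type*} [CommRing R] [Algebra ℚ R] (z : R) (L : R →ₗ[ℚ] ℚ)
    (p q : ℕ → R)
    (hp : ∀ i, ∃ P : ℚ[X], P.Monic ∧ P.natDegree = i ∧ aeval z P = p i)
    (hq : ∀ i, ∃ P : ℚ[X], P.Monic ∧ P.natDegree = i ∧ aeval z P = q i) (N : ℕ) :
    Matrix.det (Matrix.of fun i j : Fin N => L (p i * q j)) =
      Matrix.det (Matrix.of fun i j : Fin N => L (z ^ ((i : ℕ) + (j : ℕ)))) := by
  choose P hPm hPd hPz using hp
  choose Q hQm hQd hQz using hq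
  have key : ∀ S : ℕ → ℚ[X], (∀ i, (S i).Monic) → (∀ i, (S i).natDegree = i) →
      Matrix.det (Matrix.of fun i j : Fin N => (S i).coeff j) = 1 := by
    intro S hm hd
    rw [Matrix.det_of_isLowerTriangular]
    · apply Finset.prod_eq_one
      intro i _
      have := hm i
      rw [Monic, leadingCoeff, hd] at this
      simpa using this
    · intro i j hij
      apply coeff_eq_zero_of_natDegree_lt
      rw [hd]
      exact hij
  have e : (Matrix.of fun i j : Fin N => L (p i * q j)) =
      (Matrix.of fun i j : Fin N => (P i).coeff j) *
      (Matrix.of fun i j : Fin N => L (z ^ ((i : ℕ) + (j : ℕ)))) *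
      (Matrix.of fun i j : Fin N => (Q i).coeff j).transpose := by
    ext i j
    have h1 : p i = ∑ a : Fin N, (P i).coeff a • z ^ (a : ℕ) := by
      rw [← hPz, aeval_eq_sum_range' (n := N) (by rw [hPd]; exact i.2), Finset.sum_range]
    have h2 : q j = ∑ a : Fin N, (Q j).coeff a • z ^ (a : ℕ) := by
      rw [← hQz, aeval_eq_sum_range' (n := N) (by rw [hQd]; exact j.2), Finset.sum_range]
    simp only [Matrix.of_apply, Matrix.mul_apply, Matrix.transpose_apply]
    rw [h1, h2, Finset.mul_sum, map_sum]
    refine Finset.sum_congr rfl fun b _ => ?_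
    rw [Finset.sum_mul, map_sum, Finset.sum_mul]
    refine Finset.sum_congr rfl fun a _ => ?_
    rw [smul_mul_smul_comm, map_smul, pow_add, smul_eq_mul]
    ring
  rw [e, Matrix.det_mul, Matrix.det_mul, Matrix.det_transpose, key P hPm hPd, key Q hQm hQd]
  ring

open LaurentPolynomial

/-- `z = t + 2 + 1/t`. -/
noncomputable def zz : LaurentPolynomial ℚ := T 1 + 2 + T (-1)

/-- The functional: coefficient of `t^k` minus coefficient of `t^(k+1)`. -/
noncomputable def LL (k : ℕ) : LaurentPolynomial ℚ →ₗ[ℚ] ℚ where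
  toFun f := f.coeff (k : ℤ) - f.coeff ((k : ℤ) + 1)
  map_add' f g := by
    simp only [AddMonoidAlgebra.coeff_add, Finsupp.add_apply]; ring
  map_smul' a f := by
    simp only [AddMonoidAlgebra.coeff_smul, Finsupp.smul_apply, smul_eq_mul, RingHom.id_apply]
    ring

theorem LL_T (k : ℕ) (n : ℤ) :
    LL k (T n) = (if n = k then 1 else 0) - (if n = k + 1 then 1 else 0) := by
  simp only [LL, LinearMap.coe_mk, AddHom.coe_mk, T_apply]

theorem zz_pow (n : ℕ) :
    zz ^ n = ∑ m ∈ Finset.range (2 * n + 1), ((2 * n).choose m : ℚ) • T ((m : ℤ) - n) := by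
  have h : zz = T (-1) * (T 1 + 1) ^ 2 := by
    have e1 : (T (-1) * T 1 : LaurentPolynomial ℚ) = 1 := by rw [← T_add]; simp
    rw [zz]
    linear_combination (-(T 1 : LaurentPolynomial ℚ) - 2) * e1
  rw [h, mul_pow, ← pow_mul, add_pow, T_pow, Finset.mul_sum]
  refine Finset.sum_congr rfl fun m _ => ?_
  rw [T_pow, one_pow, mul_one, smul_eq_C_mul, ← mul_assoc, ← T_add, mul_comm, map_natCast]
  congr 2
  ring

theorem LL_zz_pow (k n : ℕ) : LL k (zz ^ n) = Ccat (2 * k + 1) ((n : ℤ) - k) := by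
  have hs : LL k (zz ^ n) = ((2 * n).choose (n + k) : ℚ) - ((2 * n).choose (n + k + 1) : ℚ) := by
    have g : ∀ c : ℕ, (∑ m ∈ Finset.range (2 * n + 1),
        if m = c then ((2 * n).choose m : ℚ) else 0) = ((2 * n).choose c : ℚ) := by
      intro c
      rw [Finset.sum_ite_eq']
      split_ifs with h
      · rfl
      · rw [Nat.choose_eq_zero_of_lt]
        · simp
        · rw [Finset.mem_range] at h; omega
    rw [zz_pow, map_sum, ← g (n + k), ← g (n + k + 1), ← Finset.sum_sub_distrib]
    refine Finset.sum_congr rfl fun m _ => ?_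
    rw [map_smul, LL_T, smul_eq_mul, mul_sub, mul_ite, mul_ite, mul_one, mul_zero]
    congr 1
    · exact if_congr (by omega) rfl rfl
    · exact if_congr (by omega) rfl rfl
  rw [hs, Ccat]
  split_ifs with h
  · obtain ⟨d, rfl⟩ : ∃ d, n = k + d := ⟨n - k, by omega⟩
    have e1 : (((k + d : ℕ) : ℤ) - (k : ℤ)) = (d : ℤ) := by push_cast; ring
    rw [e1, Int.toNat_natCast]
    have e2 : 2 * d + (2 * k + 1) - 1 = 2 * (k + d) := by omega
    rw [e2]
    have e3 : (2 * (k + d)).choose d = (2 * (k + d)).choose (k + d + k) := by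
      rw [← Nat.choose_symm_of_eq_add]; omega
    rw [e3]
    have e4 := Nat.choose_succ_right_eq (2 * (k + d)) (k + d + k)
    have e5 : 2 * (k + d) - (k + d + k) = d := by omega
    rw [e5] at e4
    have e6 : ((2 * (k + d)).choose (k + d + k + 1) : ℚ) * (k + d + k + 1) =
      (2 * (k + d)).choose (k + d + k) * d := by exact_mod_cast e4
    have : ((d : ℤ) : ℚ) + ((2 * k + 1 : ℕ) : ℚ) ≠ 0 := by positivity
    rw [div_mul_eq_mul_div, eq_div_iff this]
    push_cast
    linear_combination -e6
  · rw [Nat.choose_eq_zero_of_lt (by omega), Nat.choose_eq_zero_of_lt (by omega)]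
    simp

section Mon
open Polynomial

/-- `f` is a monic polynomial of degree `n` in `zz`. -/
def Mon (n : ℕ) (f : LaurentPolynomial ℚ) : Prop :=
  ∃ P : ℚ[X], P.Monic ∧ P.natDegree = n ∧ aeval zz P = f

/-- `f` is a polynomial of degree less than `n` in `zz`. -/
def Low (n : ℕ) (f : LaurentPolynomial ℚ) : Prop :=
  ∃ P : ℚ[X], P.degree < (n : WithBot ℕ) ∧ aeval zz P = f

theorem Mon.add {n : ℕ} {f g : LaurentPolynomial ℚ} (hf : Mon n f) (hg : Low n g) :
    Mon n (f + g) := by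
  obtain ⟨P, h1, h2, rfl⟩ := hf
  obtain ⟨Q, h3, rfl⟩ := hg
  have h : Q.degree < P.degree := by
    rw [degree_eq_natDegree h1.ne_zero, h2]; exact h3
  refine ⟨P + Q, h1.add_of_left h, ?_, by simp⟩
  rw [natDegree_add_eq_left_of_degree_lt h, h2]

theorem Mon.low {n m : ℕ} {f : LaurentPolynomial ℚ} (hf : Mon n f) (h : n < m) : Low m f := by
  obtain ⟨P, h1, h2, rfl⟩ := hf
  refine ⟨P, ?_, rfl⟩
  rw [degree_eq_natDegree h1.ne_zero, h2]
  exact_mod_cast h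

theorem Low.mono {n m : ℕ} {f : LaurentPolynomial ℚ} (hf : Low n f) (h : n ≤ m) : Low m f := by
  obtain ⟨P, h1, rfl⟩ := hf
  exact ⟨P, h1.trans_le (by exact_mod_cast h), rfl⟩

theorem Low.neg {n : ℕ} {f : LaurentPolynomial ℚ} (hf : Low n f) : Low n (-f) := by
  obtain ⟨P, h1, rfl⟩ := hf
  exact ⟨-P, by rwa [degree_neg], by simp⟩

theorem Mon.step {n : ℕ} {f : LaurentPolynomial ℚ} (hf : Mon n f) :
    Mon (n + 1) ((T 1 + T (-1)) * f) := by
  obtain ⟨P, h1, h2, rfl⟩ := hf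
  refine ⟨(X - Polynomial.C 2) * P, (monic_X_sub_C 2).mul h1, ?_, ?_⟩
  · rw [(monic_X_sub_C 2).natDegree_mul h1, natDegree_X_sub_C, h2, add_comm]
  · rw [map_mul]
    congr 1
    rw [zz, map_sub, Polynomial.aeval_X, Polynomial.aeval_C, map_ofNat]
    ring

theorem Mon.one : Mon 0 1 := ⟨1, monic_one, by simp, by simp⟩

theorem Low.const (c : ℚ) : Low 1 (algebraMap ℚ _ c) :=
  ⟨Polynomial.C c, degree_C_le.trans_lt (by norm_num), by simp⟩

end Mon

theorem mon_u : ∀ n : ℕ, Mon (n + 1) (T ((n : ℤ) + 1) + T (-((n : ℤ) + 1)))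
  | 0 => by simpa using Mon.one.step
  | 1 => by
    have h := (mon_u 0).step.add (((Low.const 2).mono (show 1 ≤ 0 + 1 + 1 by omega)).neg)
    convert h using 1
    simp only [map_ofNat]
    have e1 : (T (-1) * T 1 : LaurentPolynomial ℚ) = 1 := by rw [← T_add]; simp
    have e2 : (T 2 : LaurentPolynomial ℚ) = T 1 * T 1 := by rw [← T_add]; norm_num
    have e3 : (T (-2) : LaurentPolynomial ℚ) = T (-1) * T (-1) := by rw [← T_add]; norm_num
    norm_num
    rw [e2, e3]
    linear_combination -2 * e1
  | n + 2 => by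
    have h := (mon_u (n + 1)).step.add (((mon_u n).low (show n + 1 < n + 1 + 1 + 1 by omega)).neg)
    convert h using 1
    push_cast
    simp only [add_mul, mul_add, ← T_add]
    ring_nf

/-- Symmetric sums. -/
noncomputable def SS (c : ℤ → Prop) [DecidablePred c] (n : ℕ) : LaurentPolynomial ℚ :=
  ∑ m ∈ Finset.Icc (-(n : ℤ)) n, if c m then T m else 0

theorem SS_succ (c : ℤ → Prop) [DecidablePred c] (n : ℕ) (hc : ∀ m, c (-m) ↔ c m) :
    SS c (n + 1) =
      (if c ((n : ℤ) + 1) then T ((n : ℤ) + 1) + T (-((n : ℤ) + 1)) else 0) + SS c n := by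
  have e : Finset.Icc (-((n + 1 : ℕ) : ℤ)) ((n + 1 : ℕ) : ℤ) =
      insert ((n : ℤ) + 1) (insert (-((n : ℤ) + 1)) (Finset.Icc (-(n : ℤ)) n)) := by
    ext x
    simp only [Finset.mem_Icc, Finset.mem_insert]
    omega
  rw [SS, e, Finset.sum_insert, Finset.sum_insert, SS]
  · have := hc ((n : ℤ) + 1)
    by_cases h : c ((n : ℤ) + 1)
    · rw [if_pos h, if_pos h, if_pos (this.2 h)]; ring
    · rw [if_neg h, if_neg h, if_neg (fun h' => h (this.1 h'))]; ring
  · simp only [Finset.mem_Icc]; omega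
  · simp only [Finset.mem_Icc, Finset.mem_insert]; omega

theorem Low.zero (n : ℕ) : Low n 0 := ⟨0, by simp, by simp⟩

theorem low_SS (c : ℤ → Prop) [DecidablePred c] (hc : ∀ m, c (-m) ↔ c m) (n : ℕ) :
    Low (n + 1) (SS c n) := by
  induction n with
  | zero =>
    simp only [SS]
    by_cases h : c 0
    · simpa [h] using Mon.one.low (show 0 < 1 by omega)
    · simpa [h] using Low.zero 1
  | succ n ih =>
    rw [SS_succ c n hc]
    split_ifs
    · exact ((mon_u n).add ih).low (by omega)
    · rw [zero_add]; exact ih.mono (by omega)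

theorem mon_SS (c : ℤ → Prop) [DecidablePred c] (hc : ∀ m, c (-m) ↔ c m) (n : ℕ) (h : c n) :
    Mon n (SS c n) := by
  cases n with
  | zero =>
    have h' : c 0 := by simpa using h
    simpa [SS, h'] using Mon.one
  | succ n =>
    rw [SS_succ c n hc, if_pos (by exact_mod_cast h)]
    exact (mon_u n).add (low_SS c hc n)

theorem LL_T_mul (k j : ℕ) (m : ℤ) : LL k (T m * SS (fun _ => True) j) =
    (if m = k - j then 1 else 0) - (if m = k + j + 1 then 1 else 0) := by
  have g : ∀ a : ℤ, (∑ l ∈ Finset.Icc (-(j : ℤ)) j, if m + l = a then (1 : ℚ) else 0) =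
      if a - m ∈ Finset.Icc (-(j : ℤ)) j then 1 else 0 := by
    intro a
    rw [← Finset.sum_ite_eq' (Finset.Icc (-(j : ℤ)) j) (a - m) (fun _ => (1 : ℚ))]
    refine Finset.sum_congr rfl fun l _ => if_congr (by omega) rfl rfl
  rw [SS, Finset.mul_sum, map_sum]
  simp only [if_true, ← T_add, LL_T]
  rw [Finset.sum_sub_distrib, g, g]
  simp only [Finset.mem_Icc]
  split_ifs <;> first | omega | norm_num

theorem LL_SS (k i j : ℕ) (c : ℤ → Prop) [DecidablePred c] :
    LL k (SS c i * SS (fun _ => True) j) =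
    (if c ((k : ℤ) - j) ∧ (k : ℤ) - j ≤ i ∧ (j : ℤ) - k ≤ i then 1 else 0) -
      (if c ((k : ℤ) + j + 1) ∧ (k : ℤ) + j + 1 ≤ i then 1 else 0) := by
  have g : ∀ a : ℤ, (∑ m ∈ Finset.Icc (-(i : ℤ)) i,
      if m = a then (if c m then (1 : ℚ) else 0) else 0) =
      if c a ∧ a ≤ i ∧ -a ≤ i then 1 else 0 := by
    intro a
    rw [Finset.sum_ite_eq', ← ite_and]
    refine if_congr ?_ rfl rfl
    rw [Finset.mem_Icc]
    constructor
    · rintro ⟨⟨h1, h2⟩, h3⟩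
      exact ⟨h3, h2, by omega⟩
    · rintro ⟨h3, h2, h1⟩
      exact ⟨⟨by omega, h2⟩, h3⟩
  have e : ∀ m : ℤ, LL k ((if c m then T m else 0) * SS (fun _ => True) j) =
      (if m = (k : ℤ) - j then (if c m then (1 : ℚ) else 0) else 0) -
      (if m = (k : ℤ) + j + 1 then (if c m then (1 : ℚ) else 0) else 0) := by
    intro m
    by_cases h : c m
    · simp only [if_pos h, LL_T_mul]
    · simp only [if_neg h, zero_mul, map_zero, ite_self, sub_zero]
  rw [SS, Finset.sum_mul, map_sum]
  simp only [e]
  rw [Finset.sum_sub_distrib, g, g]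
  congr 1
  · exact if_congr (by rw [neg_sub]) rfl rfl
  · refine if_congr ?_ rfl rfl
    constructor
    · rintro ⟨h1, h2, _⟩; exact ⟨h1, h2⟩
    · rintro ⟨h1, h2⟩; exact ⟨h1, h2, by omega⟩

/-- The sparse matrix. -/
def EE (k i j : ℕ) : Prop :=
  (((2 * k + 1 : ℕ) : ℤ) ∣ (k : ℤ) - j - i ∨ ((2 * k + 1 : ℕ) : ℤ) ∣ (k : ℤ) - j + i) ∧
    k ≤ i + j ∧ j ≤ i + k ∧ i ≤ j + k

open Classical in
/-- The sparse matrix, entries. -/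
noncomputable def MM (k i j : ℕ) : ℚ := if EE k i j then 1 else 0

open Classical in
theorem Dcat_eq (k N : ℕ) : Dcat (2 * k + 1) (-(k : ℤ)) N =
    Matrix.det (Matrix.of fun i j : Fin N => MM k i j) := by
  have h := det_monic zz (LL k)
    (fun i => SS (fun m => ((2 * k + 1 : ℕ) : ℤ) ∣ m - i ∨ ((2 * k + 1 : ℕ) : ℤ) ∣ m + i) i)
    (SS (fun _ => True))
    (fun i => mon_SS _ (fun m => by
      rw [or_comm, ← dvd_neg, neg_add, neg_neg, ← sub_eq_add_neg,
        ← dvd_neg (b := -m - (i : ℤ)), neg_sub, sub_neg_eq_add, add_comm (i : ℤ)]) i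
      (Or.inl (by simp)))
    (fun i => mon_SS _ (fun _ => Iff.rfl) i trivial) N
  rw [Dcat]
  have e1 : (Matrix.of fun i j : Fin N => Ccat (2 * k + 1) ((i : ℤ) + (j : ℤ) + -(k : ℤ))) =
      Matrix.of fun i j : Fin N => LL k (zz ^ ((i : ℕ) + (j : ℕ))) := by
    ext i j
    simp only [Matrix.of_apply, LL_zz_pow]
    push_cast
    rw [sub_eq_add_neg]
  rw [e1, ← h]
  congr 1
  ext i j
  simp only [Matrix.of_apply, LL_SS, MM]
  have d1 : ((2 * k + 1 : ℕ) : ℤ) ∣ (k : ℤ) + j + 1 - i ↔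
      ((2 * k + 1 : ℕ) : ℤ) ∣ (k : ℤ) - j + i := by
    rw [← dvd_neg, ← dvd_add_right (dvd_refl _)]
    rw [show ((2 * k + 1 : ℕ) : ℤ) + -((k : ℤ) + j + 1 - i) = (k : ℤ) - j + i by push_cast; ring]
  have d2 : ((2 * k + 1 : ℕ) : ℤ) ∣ (k : ℤ) + j + 1 + i ↔
      ((2 * k + 1 : ℕ) : ℤ) ∣ (k : ℤ) - j - i := by
    rw [← dvd_neg, ← dvd_add_right (dvd_refl _)]
    rw [show ((2 * k + 1 : ℕ) : ℤ) + -((k : ℤ) + j + 1 + i) = (k : ℤ) - j - i by push_cast; ring]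
  simp only [d1, d2]
  unfold EE
  by_cases hc : (((2 * k + 1 : ℕ) : ℤ) ∣ (k : ℤ) - (j : ℕ) - (i : ℕ) ∨
    ((2 * k + 1 : ℕ) : ℤ) ∣ (k : ℤ) - (j : ℕ) + (i : ℕ))
  · have hc' := hc.symm
    simp only [hc, hc', true_and]
    split_ifs <;> first | omega | norm_num
  · have hc' := mt Or.symm hc
    simp only [hc, hc', false_and, if_false, sub_zero]

theorem dvd_of_eq_of_dvd {a b c : ℤ} (h : b = c) (h' : a ∣ c) : a ∣ b := h ▸ h'

theorem EE_iff₁ (k q r j : ℕ) (hq : ((2 * k + 1 : ℕ) : ℤ) ∣ q) (hr : r ≤ k) :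
    EE k (q + r) j ↔ j + r = q + k ∨ j = q + k + r := by
  unfold EE
  constructor
  · rintro ⟨h | h, h1, h2, h3⟩
    · left
      have h' : ((2 * k + 1 : ℕ) : ℤ) ∣ (j : ℤ) - q - k + r := by
        have := (dvd_neg.2 h).sub (hq.mul_left 2)
        refine (dvd_of_eq_of_dvd ?_ this)
        push_cast; ring
      have := Int.eq_zero_of_abs_lt_dvd h' (by rw [abs_lt]; constructor <;> omega)
      omega
    · right
      have := Int.eq_zero_of_abs_lt_dvd h (by rw [abs_lt]; constructor <;> omega)
      omega
  · rintro (h | rfl)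
    · refine ⟨Or.inl ?_, ?_⟩
      · refine dvd_of_eq_of_dvd ?_ (dvd_neg.2 (hq.mul_left 2))
        omega
      · refine ⟨?_, ?_, ?_⟩ <;> omega
    · refine ⟨Or.inr ⟨0, ?_⟩, ?_⟩
      · push_cast; ring
      · refine ⟨?_, ?_, ?_⟩ <;> omega

theorem EE_iff₂ (k q s j : ℕ) (hq : ((2 * k + 1 : ℕ) : ℤ) ∣ q) (hs : s < k) :
    EE k (q + k + 1 + s) j ↔ j + s = q + 2 * k ∨ j = q + 2 * k + 1 + s := by
  unfold EE
  constructor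
  · rintro ⟨h | h, h1, h2, h3⟩
    · left
      have h' : ((2 * k + 1 : ℕ) : ℤ) ∣ (j : ℤ) - q - 2 * k + s := by
        have := ((dvd_neg.2 h).sub (hq.mul_left 2)).sub (dvd_refl _)
        refine (dvd_of_eq_of_dvd ?_ this)
        push_cast; ring
      have := Int.eq_zero_of_abs_lt_dvd h' (by rw [abs_lt]; constructor <;> omega)
      omega
    · right
      have := Int.eq_zero_of_abs_lt_dvd h (by rw [abs_lt]; constructor <;> omega)
      omega
  · rintro (h | rfl)
    · refine ⟨Or.inl ?_, ?_⟩
      · refine dvd_of_eq_of_dvd ?_ (dvd_neg.2 ((hq.mul_left 2).add (dvd_refl _)))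
        push_cast
        omega
      · refine ⟨?_, ?_, ?_⟩ <;> omega
    · refine ⟨Or.inr ⟨0, ?_⟩, ?_⟩
      · push_cast; ring
      · refine ⟨?_, ?_, ?_⟩ <;> omega

theorem det_anti (s : ℕ) : Matrix.det (Matrix.of fun i j : Fin s =>
    if (i : ℕ) + (j : ℕ) + 1 = s then (1 : ℚ) else 0) = (-1) ^ (s.choose 2) := by
  induction s with
  | zero => simp
  | succ n ih =>
    rw [Matrix.det_succ_row_zero, Finset.sum_eq_single (Fin.last n)]
    · rw [Nat.choose_succ_succ', pow_add, ← ih]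
      simp only [Matrix.of_apply, Fin.val_last, Fin.val_zero, zero_add, if_true, mul_one,
        Nat.choose_one_right]
      congr 2
      ext i j
      simp only [Matrix.submatrix_apply, Matrix.of_apply, Fin.succAbove_last, Fin.val_succ,
        Fin.val_castSucc]
      exact if_congr (by omega) rfl rfl
    · intro j _ hj
      have : (j : ℕ) ≠ n := fun h => hj (Fin.ext h)
      simp [this]
    · simp

/-- The leading determinants of the sparse matrix. -/
noncomputable def dd (k N : ℕ) : ℚ := Matrix.det (Matrix.of fun i j : Fin N => MM k i j)

theorem dd_add (k N s : ℕ) (h0 : ∀ i < s, ∀ j < N, ¬ EE k (N + i) j)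
    (h1 : ∀ i < s, ∀ j < s, EE k (N + i) (N + j) ↔ i + j + 1 = s) :
    dd k (N + s) = dd k N * (-1) ^ (s.choose 2) := by
  rw [← det_anti, dd, dd, ← Matrix.det_submatrix_equiv_self (finSumFinEquiv (m := N) (n := s)),
    ← Matrix.fromBlocks_toBlocks (Matrix.submatrix _ _ _)]
  have z : (Matrix.submatrix (Matrix.of fun i j : Fin (N + s) => MM k i j)
      (finSumFinEquiv (m := N) (n := s)) (finSumFinEquiv (m := N) (n := s))).toBlocks₂₁ = 0 := by
    ext i j
    simp [Matrix.toBlocks₂₁, MM, h0 i i.2 j j.2]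
  rw [z, Matrix.det_fromBlocks_zero₂₁]
  congr 2
  · ext i j
    simp [Matrix.toBlocks₂₂, MM, h1 i i.2 j j.2]

theorem dd_zero (k N i : ℕ) (hi : i < N) (h : ∀ j < N, ¬ EE k i j) : dd k N = 0 := by
  rw [dd]
  apply Matrix.det_eq_zero_of_row_eq_zero ⟨i, hi⟩
  intro j
  simp [MM, h j j.2]

theorem dd_step₁ (k q : ℕ) (hq : ((2 * k + 1 : ℕ) : ℤ) ∣ q) :
    dd k (q + (k + 1)) = dd k q * (-1) ^ ((k + 1).choose 2) := by
  apply dd_add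
  · intro i hi j hj
    rw [EE_iff₁ k q i j hq (by omega)]; omega
  · intro i hi j hj
    rw [EE_iff₁ k q i _ hq (by omega)]; omega

theorem dd_step₂ (k q : ℕ) (hq : ((2 * k + 1 : ℕ) : ℤ) ∣ q) :
    dd k (q + k + 1 + k) = dd k (q + k + 1) * (-1) ^ (k.choose 2) := by
  apply dd_add
  · intro i hi j hj
    rw [EE_iff₂ k q i j hq (by omega)]; omega
  · intro i hi j hj
    rw [EE_iff₂ k q i _ hq (by omega)]; omega

theorem dvd_q (k n : ℕ) : ((2 * k + 1 : ℕ) : ℤ) ∣ (((2 * k + 1) * n : ℕ) : ℤ) :=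
  ⟨n, by push_cast; ring⟩

theorem dd_mul (k n : ℕ) : dd k ((2 * k + 1) * n) = (-1 : ℚ) ^ (k * n) := by
  induction n with
  | zero => simp [dd]
  | succ n ih =>
    have e : (2 * k + 1) * (n + 1) = (2 * k + 1) * n + k + 1 + k := by ring
    rw [e, dd_step₂ k _ (dvd_q k n), add_assoc, dd_step₁ k _ (dvd_q k n), ih,
      Nat.choose_succ_succ', Nat.choose_one_right, pow_add, mul_add, pow_add, mul_one]
    have : ((-1 : ℚ) ^ (k.choose 2)) * (-1) ^ (k.choose 2) = 1 := by
      rw [← mul_pow]; simp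
    linear_combination ((-1 : ℚ) ^ (k * n) * (-1) ^ k) * this

theorem dd_mul_add (k n : ℕ) :
    dd k ((2 * k + 1) * n + k + 1) = (-1 : ℚ) ^ (k * n + (k + 1).choose 2) := by
  rw [add_assoc, dd_step₁ k _ (dvd_q k n), dd_mul, pow_add]

theorem dd_other (k N : ℕ) (h1 : ¬ ∃ n : ℕ, N = (2 * k + 1) * n)
    (h2 : ¬ ∃ n : ℕ, N = (2 * k + 1) * n + k + 1) : dd k N = 0 := by
  have hN := Nat.div_add_mod N (2 * k + 1)
  have hr := Nat.mod_lt N (show 0 < 2 * k + 1 by omega)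
  have hq := dvd_q k (N / (2 * k + 1))
  have h1' : N ≠ (2 * k + 1) * (N / (2 * k + 1)) := fun h => h1 ⟨_, h⟩
  have h2' : N ≠ (2 * k + 1) * (N / (2 * k + 1)) + k + 1 := fun h => h2 ⟨_, h⟩
  generalize (2 * k + 1) * (N / (2 * k + 1)) = q at *
  generalize N % (2 * k + 1) = r at *
  by_cases hk : r ≤ k
  · apply dd_zero k N (q + 0) (by omega)
    intro j hj
    rw [EE_iff₁ k q 0 j hq (by omega)]; omega
  · apply dd_zero k N (q + k + 1 + 0) (by omega)
    intro j hj
    rw [EE_iff₂ k q 0 j hq (by omega)]; omega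

end HankelCat

/-- `D_{2k+1,-k}((2k+1)n) = (-1)^{kn}`, `D_{2k+1,-k}((2k+1)n+k+1) = (-1)^{kn+binom(k+1,2)}`,
and `D_{2k+1,-k}(N) = 0` for all other positive `N`. -/
theorem stmt9 (k : ℕ) (hk : 0 < k) :
    (∀ n : ℕ, Dcat (2 * k + 1) (-(k : ℤ)) ((2 * k + 1) * n) = (-1 : ℚ) ^ (k * n)) ∧
      (∀ n : ℕ, Dcat (2 * k + 1) (-(k : ℤ)) ((2 * k + 1) * n + k + 1) =
          (-1 : ℚ) ^ (k * n + (k + 1).choose 2)) ∧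
      (∀ N : ℕ, 0 < N → (¬ ∃ n : ℕ, N = (2 * k + 1) * n) →
        (¬ ∃ n : ℕ, N = (2 * k + 1) * n + k + 1) →
        Dcat (2 * k + 1) (-(k : ℤ)) N = 0) := by
  refine ⟨fun n => ?_, fun n => ?_, fun N _ h1 h2 => ?_⟩
  · rw [HankelCat.Dcat_eq]; exact HankelCat.dd_mul k n
  · rw [HankelCat.Dcat_eq]; exact HankelCat.dd_mul_add k n
  · rw [HankelCat.Dcat_eq]; exact HankelCat.dd_other k N h1 h2
end
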